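/- arXiv:math/0601520 — 2 statements merged into one kernel-verified Lean document; each statement's English description precedes it below -/
import Mathlib

section
/- Let v_1, …, v_q ∈ ℕ^n, 𝒜' = {e_1, …, e_n, (v_1,1), …, (v_q,1)} ⊆ ℝ^{n+1}, and P = conv(v_1,…,v_q). Suppose (i) the Rees cone ℝ_+𝒜' is quasi-ideal, i.e., it admits a representation ℝ_+𝒜' = (⋂_{i∈J} H_{e_i}^+) ∩ (⋂_{k=1}^r H_{ℓ_k}^+) with each ℓ_k = −d_k e_{n+1} + Σ_{i∈A_k} e_i for some A_k ⊆ {1,…,n} and d_k ∈ ℕ, and (ii) for every b ∈ ℕ, every lattice point a ∈ ℤ^n ∩ bP is a sum of b of the vectors v_1,…,v_q (with repetitions allowed). Then ℤ^{n+1} ∩ ℝ_+𝒜' = ℕ𝒜', i.e., every lattice point of the Rees cone is a nonnegative integer combination of the vectors in 𝒜'. (Ring-theoretically: the Rees algebra R[It] of I = (x^{v_1},…,x^{v_q}) is normal.) -/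
open Finset Pointwise

/-- The generators of the Rees cone of the monomial ideal generated by
`x^{v_1}, …, x^{v_q}`: the unit vectors `e_1, …, e_n` together with the
vectors `(v_j, 1)` in `ℝ^{n+1}`. -/
noncomputable def reesGen (n q : ℕ) (v : Fin q → Fin n → ℕ) :
    Fin n ⊕ Fin q → (Fin (n + 1) → ℝ)
  | Sum.inl i => Pi.single i.castSucc 1
  | Sum.inr j => Fin.snoc (fun i => (v j i : ℝ)) 1

/-- The integral version of the generators of the Rees cone. -/
def reesGenZ (n q : ℕ) (v : Fin q → Fin n → ℕ) :
    Fin n ⊕ Fin q → (Fin (n + 1) → ℤ)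
  | Sum.inl i => Pi.single i.castSucc 1
  | Sum.inr j => Fin.snoc (fun i => (v j i : ℤ)) 1

/-- The Rees cone: all nonnegative real linear combinations of the generators. -/
noncomputable def reesCone (n q : ℕ) (v : Fin q → Fin n → ℕ) :
    Set (Fin (n + 1) → ℝ) :=
  {y | ∃ lam : Fin n ⊕ Fin q → ℝ, (∀ s, 0 ≤ lam s) ∧ y = ∑ s, lam s • reesGen n q v s}

/-- The Rees cone in coordinates. -/
theorem mem_reesCone_iff {n q : ℕ} {v : Fin q → Fin n → ℕ} {y : Fin (n + 1) → ℝ} :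
    y ∈ reesCone n q v ↔ ∃ (c : Fin n → ℝ) (w : Fin q → ℝ), (∀ i, 0 ≤ c i) ∧ (∀ j, 0 ≤ w j) ∧
      (∀ i, y i.castSucc = c i + ∑ j, w j * v j i) ∧ y (Fin.last n) = ∑ j, w j := by
  constructor
  · rintro ⟨lam, hlam, rfl⟩
    refine ⟨fun i => lam (Sum.inl i), fun j => lam (Sum.inr j), fun i => hlam _, fun j => hlam _,
      fun i => ?_, ?_⟩
    · simp [reesGen, Finset.sum_apply, Pi.single_apply]
    · simp [reesGen, Finset.sum_apply, (Fin.castSucc_lt_last _).ne']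
  · rintro ⟨c, w, hc, hw, h, hlast⟩
    refine ⟨Sum.elim c w, fun s => by cases s <;> simp [hc, hw], funext fun i => ?_⟩
    induction i using Fin.lastCases with
    | last =>
      simp [reesGen, Finset.sum_apply, (Fin.castSucc_lt_last _).ne', hlast]
    | cast i => simp [reesGen, Finset.sum_apply, Pi.single_apply, h]

/-- The integral combinations of the generators in coordinates. -/
theorem eq_sum_smul_reesGenZ_iff {n q : ℕ} {v : Fin q → Fin n → ℕ} {z : Fin (n + 1) → ℤ}
    {μ : Fin n ⊕ Fin q → ℕ} :
    z = ∑ s, (μ s : ℤ) • reesGenZ n q v s ↔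
      (∀ i, z i.castSucc = μ (Sum.inl i) + ∑ j, (μ (Sum.inr j) : ℤ) * v j i) ∧
        z (Fin.last n) = ∑ j, (μ (Sum.inr j) : ℤ) := by
  rw [funext_iff, Fin.forall_fin_succ']
  simp [reesGenZ, Finset.sum_apply, Pi.single_apply, (Fin.castSucc_lt_last _).ne']

/-- A nonnegative combination of points with total weight `b` lies in the `b`-th dilation
of their convex hull. -/
theorem sum_smul_mem_smul_convexHull {ι E : Type*} [Fintype ι] [Nonempty ι] [AddCommGroup E]
    [Module ℝ E] (x : ι → E) (w : ι → ℝ) (hw : ∀ j, 0 ≤ w j) :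
    ∑ j, w j • x j ∈ (∑ j, w j) • convexHull ℝ (Set.range x) := by
  rcases (Finset.sum_nonneg fun j _ => hw j : 0 ≤ ∑ j, w j).eq_or_lt with h | h
  · have h0 : ∀ j, w j = 0 := fun j =>
      (Finset.sum_eq_zero_iff_of_nonneg fun j _ => hw j).1 h.symm j (Finset.mem_univ j)
    rw [← h, Set.zero_smul_set ((Set.range_nonempty x).convexHull)]
    simp [h0]
  · refine ⟨Finset.univ.centerMass w x, ?_, ?_⟩
    · exact Finset.centerMass_mem_convexHull _ (fun j _ => hw j) h fun j _ => Set.mem_range_self j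
    · simp [Finset.centerMass, smul_smul, h.ne']

/-- If a quasi-ideal cone contains an integral point `z` together with `z - t • e_i` for some
`t > 0`, then it contains `z - e_i`. -/
theorem sub_single_mem_of_quasi_ideal {n r : ℕ} {C : Set (Fin (n + 1) → ℝ)}
    {J : Finset (Fin (n + 1))} {ℓ : Fin r → Fin (n + 1) → ℝ}
    (hℓ : ∀ k, ∃ (A : Finset (Fin n)) (dk : ℕ),
      ℓ k = (∑ i ∈ A, Pi.single i.castSucc (1 : ℝ)) -
        (dk : ℝ) • (Pi.single (Fin.last n) 1 : Fin (n + 1) → ℝ))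
    (hC : C = {y : Fin (n + 1) → ℝ | (∀ i ∈ J, 0 ≤ y i) ∧ ∀ k, 0 ≤ ∑ i, ℓ k i * y i})
    {z : Fin (n + 1) → ℤ} (hz : (fun i => (z i : ℝ)) ∈ C) {i : Fin n} {t : ℝ} (ht : 0 < t)
    (hzt : (fun j => (z j : ℝ)) - t • Pi.single i.castSucc 1 ∈ C) :
    (fun j => ((z - Pi.single i.castSucc 1 : Fin (n + 1) → ℤ) j : ℝ)) ∈ C := by
  have hpair : ∀ (L : Fin (n + 1) → ℝ) (A : Finset (Fin n)) (d : ℕ), L =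
      (∑ i ∈ A, Pi.single i.castSucc (1 : ℝ)) -
        (d : ℝ) • (Pi.single (Fin.last n) 1 : Fin (n + 1) → ℝ) → ∀ y : Fin (n + 1) → ℝ,
      ∑ i, L i * y i = ∑ i ∈ A, y i.castSucc - d * y (Fin.last n) := by
    rintro L A d rfl y
    change _ ⬝ᵥ y = _
    simp [sub_dotProduct, sum_dotProduct]
  subst hC
  obtain ⟨hJ, hk⟩ := hz
  obtain ⟨hJt, hkt⟩ := hzt
  refine ⟨fun j hj => ?_, fun k => ?_⟩
  · have h1 := hJ j hj
    have h2 := hJt j hj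
    by_cases hji : j = i.castSucc
    · subst hji
      simp only [Pi.sub_apply, Pi.smul_apply, Pi.single_eq_same, smul_eq_mul, mul_one] at h2 ⊢
      have h3 : 0 < z i.castSucc := by exact_mod_cast (by linarith : (0 : ℝ) < z i.castSucc)
      exact_mod_cast (by omega : 0 ≤ z i.castSucc - 1)
    · simpa [hji] using h1
  · obtain ⟨A, d, hA⟩ := hℓ k
    have h1 := hk k
    have h2 := hkt k
    rw [hpair _ A d hA] at h1 h2 ⊢
    have hne : Fin.last n ≠ i.castSucc := (Fin.castSucc_lt_last i).ne'
    by_cases hi : i ∈ A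
    · simp [Finset.sum_sub_distrib, Pi.single_apply, hi, hne] at h2 ⊢
      have h3 : 0 < ∑ j ∈ A, z j.castSucc - d * z (Fin.last n) := by
        have : (0 : ℝ) < ∑ j ∈ A, (z j.castSucc : ℝ) - d * z (Fin.last n) := by linarith
        exact_mod_cast this
      exact_mod_cast (by omega : (d : ℤ) * z (Fin.last n) ≤ ∑ j ∈ A, z j.castSucc - 1)
    · simpa [Finset.sum_sub_distrib, Pi.single_apply, hi, hne] using h1

/-- If the Rees cone is quasi-ideal and every lattice point of `bP` is a sum of `b`
of the vectors `v_1, …, v_q`, then every lattice point of the Rees cone is a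
nonnegative integer combination of the generators, i.e. the Rees algebra is normal. -/
theorem rees_algebra_normal_of_quasi_ideal
    (n q : ℕ) (hq : 0 < q) (v : Fin q → Fin n → ℕ)
    (J : Finset (Fin (n + 1))) (r : ℕ) (ℓ : Fin r → Fin (n + 1) → ℝ)
    (hℓ : ∀ k, ∃ (A : Finset (Fin n)) (dk : ℕ),
      ℓ k = (∑ i ∈ A, Pi.single i.castSucc (1 : ℝ)) -
        (dk : ℝ) • (Pi.single (Fin.last n) 1 : Fin (n + 1) → ℝ))
    (hrep : reesCone n q v =
      {y : Fin (n + 1) → ℝ | (∀ i ∈ J, 0 ≤ y i) ∧ ∀ k, 0 ≤ ∑ i, ℓ k i * y i})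
    (hP : ∀ (b : ℕ) (a : Fin n → ℤ),
      (fun i => (a i : ℝ)) ∈ (b : ℝ) •
        convexHull ℝ (Set.range fun j : Fin q => fun i : Fin n => (v j i : ℝ)) →
      ∃ m : Fin q → ℕ, (∑ j, m j = b) ∧ ∀ i, a i = ∑ j, (m j : ℤ) * (v j i : ℤ))
    (z : Fin (n + 1) → ℤ) :
    (fun i => (z i : ℝ)) ∈ reesCone n q v ↔
      ∃ μ : Fin n ⊕ Fin q → ℕ, z = ∑ s, (μ s : ℤ) • reesGenZ n q v s := by
  constructor
  · intro hz
    have : Nonempty (Fin q) := ⟨⟨0, hq⟩⟩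
    induction hN : (∑ i : Fin n, z i.castSucc).toNat using Nat.strong_induction_on
      generalizing z with
    | _ N ih =>
    obtain ⟨c, w, hc, hw, hzc, hlast⟩ := mem_reesCone_iff.1 hz
    by_cases hc0 : ∀ i, c i = 0
    · have hpos : 0 ≤ z (Fin.last n) := by
        exact_mod_cast hlast.symm ▸ (Finset.sum_nonneg fun j _ => hw j : 0 ≤ ∑ j, w j)
      obtain ⟨b, hb⟩ := Int.eq_ofNat_of_zero_le hpos
      have hbw : (b : ℝ) = ∑ j, w j := by rw [← hlast, hb]; simp
      obtain ⟨m, hm, hzm⟩ := hP b (fun i => z i.castSucc) (by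
        rw [hbw]
        convert sum_smul_mem_smul_convexHull (fun j => fun i : Fin n => (v j i : ℝ)) w hw using 1
        funext i
        simp [hzc, hc0, Finset.sum_apply])
      refine ⟨Sum.elim 0 m, eq_sum_smul_reesGenZ_iff.2 ⟨fun i => by simp [hzm], ?_⟩⟩
      simp [hb, ← hm]
    · push Not at hc0
      obtain ⟨i, hi⟩ := hc0
      have hne : Fin.last n ≠ i.castSucc := (Fin.castSucc_lt_last i).ne'
      have hzi : (fun j => ((z - Pi.single i.castSucc 1 : Fin (n + 1) → ℤ) j : ℝ)) ∈
          reesCone n q v := by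
        refine sub_single_mem_of_quasi_ideal hℓ hrep hz (lt_of_le_of_ne (hc i) hi.symm) ?_
        refine mem_reesCone_iff.2 ⟨c - c i • Pi.single i 1, w, fun j => ?_, hw, fun j => ?_, ?_⟩
        · by_cases hj : j = i
          · simp [hj]
          · simp [hj, hc]
        · simp only [Pi.sub_apply, Pi.smul_apply, hzc, Pi.single_apply, Fin.castSucc_inj]
          ring
        · simp [hlast, hne]
      have hsum : ∑ j : Fin n, (z - Pi.single i.castSucc 1 : Fin (n + 1) → ℤ) j.castSucc =
          ∑ j : Fin n, z j.castSucc - 1 := by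
        simp [Finset.sum_sub_distrib, Pi.single_apply]
      have hnonneg : 0 ≤ ∑ j : Fin n, z j.castSucc - 1 := by
        rw [← hsum]
        obtain ⟨c', w', hc', hw', hzc', -⟩ := mem_reesCone_iff.1 hzi
        refine Finset.sum_nonneg fun j _ => ?_
        have h : (0 : ℝ) ≤ ((z - Pi.single i.castSucc 1 : Fin (n + 1) → ℤ) j.castSucc : ℝ) := by
          rw [hzc' j]
          exact add_nonneg (hc' j)
            (Finset.sum_nonneg fun k _ => mul_nonneg (hw' k) (Nat.cast_nonneg _))
        exact_mod_cast h
      obtain ⟨μ, hμ⟩ := ih _ (by rw [hsum]; omega) _ hzi rfl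
      obtain ⟨h1, h2⟩ := eq_sum_smul_reesGenZ_iff.1 hμ
      refine ⟨μ + Pi.single (Sum.inl i) 1, eq_sum_smul_reesGenZ_iff.2 ⟨fun j => ?_, ?_⟩⟩
      · have h := h1 j
        simp only [Pi.sub_apply, Pi.single_apply, Fin.castSucc_inj] at h
        rw [eq_add_of_sub_eq h]
        simp [Pi.single_apply]
        ring
      · simpa [hne] using h2
  · rintro ⟨μ, hμ⟩
    obtain ⟨h1, h2⟩ := eq_sum_smul_reesGenZ_iff.1 hμ
    exact mem_reesCone_iff.2 ⟨fun i => μ (Sum.inl i), fun j => μ (Sum.inr j),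
      fun i => Nat.cast_nonneg _, fun j => Nat.cast_nonneg _, fun i => by simp [h1],
      by simp [h2]⟩
end

section
/- Let M be a matroid of rank d on [n] with bases B_1,…,B_q and let 𝒜' = {e_1,…,e_n, f_{B_1},…,f_{B_q}} ⊆ ℝ^{n+1}, where f_{B_i} = e_{n+1} + Σ_{j∈B_i} e_j. Then 𝒜' is an integral Hilbert basis: ℤ^{n+1} ∩ ℝ_+𝒜' = ℕ𝒜', i.e., every lattice point of the basis Rees cone is a nonnegative integer combination of elements of 𝒜'. (Ring-theoretically: the Rees algebra R[It] of the basis monomial ideal I = I(𝓑) of M is normal.) -/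
open Finset

/-- A collection `𝓘` of subsets of `[n]` is the family of independent sets of a
matroid on `[n]` if it contains the empty set, is closed under taking subsets,
and satisfies the augmentation (independence exchange) axiom. -/
def IndepSystem {n : ℕ} (𝓘 : Set (Finset (Fin n))) : Prop :=
  ∅ ∈ 𝓘 ∧
  (∀ I ∈ 𝓘, ∀ I' ⊆ I, I' ∈ 𝓘) ∧
  (∀ I₁ ∈ 𝓘, ∀ I₂ ∈ 𝓘, I₁.card < I₂.card → ∃ e ∈ I₂, e ∉ I₁ ∧ insert e I₁ ∈ 𝓘)

/-- A basis of the matroid with independent sets `𝓘` is a maximal independent set. -/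
def IsBasisOf {n : ℕ} (𝓘 : Set (Finset (Fin n))) (B : Finset (Fin n)) : Prop :=
  B ∈ 𝓘 ∧ ∀ I ∈ 𝓘, B ⊆ I → I = B

/-- The generators of the basis Rees cone of a matroid with bases `B_1, …, B_q`:
the unit vectors `e_1, …, e_n` together with the vectors
`f_{B_j} = e_{n+1} + ∑_{i ∈ B_j} e_i` in `ℝ^{n+1}`. -/
noncomputable def basisReesGen (n q : ℕ) (B : Fin q → Finset (Fin n)) :
    Fin n ⊕ Fin q → (Fin (n + 1) → ℝ)
  | Sum.inl i => Pi.single i.castSucc 1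
  | Sum.inr j => Fin.snoc (fun i => if i ∈ B j then (1 : ℝ) else 0) 1

/-- The integral version of the generators of the basis Rees cone. -/
def basisReesGenZ (n q : ℕ) (B : Fin q → Finset (Fin n)) :
    Fin n ⊕ Fin q → (Fin (n + 1) → ℤ)
  | Sum.inl i => Pi.single i.castSucc 1
  | Sum.inr j => Fin.snoc (fun i => if i ∈ B j then (1 : ℤ) else 0) 1

/-- The basis Rees cone: all nonnegative real linear combinations of the generators. -/
noncomputable def basisReesCone (n q : ℕ) (B : Fin q → Finset (Fin n)) :
    Set (Fin (n + 1) → ℝ) :=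
  {y | ∃ lam : Fin n ⊕ Fin q → ℝ, (∀ s, 0 ≤ lam s) ∧
    y = ∑ s, lam s • basisReesGen n q B s}

theorem Matroid.Indep.card_le_card_of_isBasis {α : Type*} {M : Matroid α} {I J : Finset α}
    {X : Set α} (hI : M.Indep I) (hIX : (I : Set α) ⊆ X) (hJ : M.IsBasis J X) : #I ≤ #J := by
  have h := hI.encard_le_eRk_of_subset hIX
  rw [← hJ.encard_eq_eRk, Set.encard_coe_eq_coe_finsetCard, Set.encard_coe_eq_coe_finsetCard] at h
  exact_mod_cast h

theorem Matroid.IsBase.card_eq_card {α : Type*} {M : Matroid α} {B B' : Finset α}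
    (hB : M.IsBase B) (hB' : M.IsBase B') : #B = #B' := by
  simpa only [Set.ncard_coe_finset] using hB.ncard_eq_ncard_of_isBase hB'

/-- The number of members of the family `I` containing `x`. -/
def load {ι α : Type*} [Fintype ι] [DecidableEq α] (I : ι → Finset α) (x : α) : ℕ :=
  #{t | x ∈ I t}

/-- A family of independent sets covering each element `x` at most `a x` times. -/
def IsPacking {ι α : Type*} [Fintype ι] [DecidableEq α] (M : Matroid α) (a : α → ℕ)
    (I : ι → Finset α) : Prop :=
  (∀ t, M.Indep (I t)) ∧ ∀ x, load I x ≤ a x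

/-- One member of the family `I` exchanges an element for an unsaturated one. -/
def Exchange {ι α : Type*} [Fintype ι] [DecidableEq ι] [DecidableEq α] (M : Matroid α) (a : α → ℕ)
    (I I' : ι → Finset α) : Prop :=
  ∃ t x y, x ∉ I t ∧ y ∈ I t ∧ load I x < a x ∧ M.Indep (insert x ((I t).erase y) : Finset α) ∧
    I' = Function.update I t (insert x ((I t).erase y))

theorem load_eq_sum {ι α : Type*} [Fintype ι] [DecidableEq α] (I : ι → Finset α) (x : α) :
    load I x = ∑ t, if x ∈ I t then 1 else 0 :=
  card_filter _ _

theorem sum_load {ι α : Type*} [Fintype ι] [DecidableEq α] (I : ι → Finset α) (S : Finset α) :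
    ∑ x ∈ S, load I x = ∑ t, #(I t ∩ S) := by
  simp_rw [load_eq_sum]
  rw [sum_comm]
  refine sum_congr rfl fun t _ => ?_
  rw [← card_filter, filter_mem_eq_inter, inter_comm]

theorem sum_update_add {ι β : Type*} [Fintype ι] [DecidableEq ι] (g : β → ℕ) (I : ι → β) (t : ι)
    (J : β) : ∑ s, g (Function.update I t J s) + g (I t) = ∑ s, g (I s) + g J := by
  rw [← add_sum_erase _ _ (mem_univ t), ← add_sum_erase _ (fun s => g (I s)) (mem_univ t)]
  have h : ∑ s ∈ univ.erase t, g (Function.update I t J s) = ∑ s ∈ univ.erase t, g (I s) :=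
    sum_congr rfl fun s hs => by rw [Function.update_of_ne (ne_of_mem_erase hs)]
  rw [h, Function.update_self]
  ring

section Packing

variable {ι α : Type*} [Fintype ι] [DecidableEq ι] [DecidableEq α]
  {M : Matroid α} {a : α → ℕ} {I I' : ι → Finset α}

theorem load_update_add (I : ι → Finset α) (t : ι) (J : Finset α) (x : α) :
    load (Function.update I t J) x + (if x ∈ I t then 1 else 0)
      = load I x + if x ∈ J then 1 else 0 := by
  rw [load_eq_sum, load_eq_sum]
  exact sum_update_add (fun K => if x ∈ K then 1 else 0) I t J

theorem IsPacking.update (h : IsPacking M a I) {t : ι} {J : Finset α} (hJ : M.Indep J)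
    (hload : ∀ x ∈ J, x ∉ I t → load I x < a x) : IsPacking M a (Function.update I t J) := by
  refine ⟨fun s => ?_, fun x => ?_⟩
  · obtain rfl | hs := eq_or_ne s t
    · simpa using hJ
    · simpa [hs] using h.1 s
  · have h₁ := load_update_add I t J x
    have h₂ := h.2 x
    have h₃ := hload x
    by_cases hx : x ∈ J <;> by_cases hx' : x ∈ I t <;> simp [hx, hx'] at h₁ h₃ <;> omega

theorem IsPacking.exchange (h : IsPacking M a I) (hI : Exchange M a I I') : IsPacking M a I' := by
  obtain ⟨t, x, y, hx, hy, hlt, hind, rfl⟩ := hI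
  refine h.update hind fun z hz hz' => ?_
  obtain rfl | hz := mem_insert.1 hz
  · exact hlt
  · exact absurd (mem_of_mem_erase hz) hz'

theorem Exchange.sum_card (hI : Exchange M a I I') : ∑ t, #(I' t) = ∑ t, #(I t) := by
  obtain ⟨t, x, y, hx, hy, hlt, hind, rfl⟩ := hI
  have h := sum_update_add card I t (insert x ((I t).erase y))
  rw [card_insert_of_notMem (fun hx' => hx (mem_of_mem_erase hx')), card_erase_add_one hy] at h
  exact Nat.add_right_cancel h

/-- Adjoining an unsaturated element to a member of a maximum packing creates a circuit. -/
theorem mem_closure_of_load_lt (hE : M.E = Set.univ) (h : IsPacking M a I)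
    (hmax : ∀ I' : ι → Finset α, IsPacking M a I' → ∑ t, #(I' t) ≤ ∑ t, #(I t))
    {x : α} (hx : load I x < a x) {t : ι} (hxt : x ∉ I t) : x ∈ M.closure (I t) := by
  by_contra hcl
  rw [(h.1 t).notMem_closure_iff_of_notMem (by simpa using hxt) (by simp [hE])] at hcl
  have hpack : IsPacking M a (Function.update I t (insert x (I t))) := by
    refine h.update (by simpa using hcl) fun z hz hz' => ?_
    obtain rfl | hz := mem_insert.1 hz
    · exact hx
    · exact absurd hz hz'
  have h₁ := sum_update_add card I t (insert x (I t))
  rw [card_insert_of_notMem hxt] at h₁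
  have h₂ := hmax _ hpack
  omega

/-- If every element reachable by an exchange lies in `R`, then `R ∩ I t` spans each unsaturated
element. -/
theorem mem_closure_inter_of_load_lt (hE : M.E = Set.univ) (h : IsPacking M a I)
    (hmax : ∀ I' : ι → Finset α, IsPacking M a I' → ∑ t, #(I' t) ≤ ∑ t, #(I t))
    {R : Set α} (hR : ∀ z, load I z < a z → z ∈ R)
    (hR' : ∀ I', Exchange M a I I' → ∀ z, load I' z < a z → z ∈ R)
    {x : α} (hx : load I x < a x) (t : ι) : x ∈ M.closure (I t ∩ R) := by
  by_cases hxt : x ∈ I t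
  · exact M.mem_closure_of_mem' ⟨by simpa using hxt, hR x hx⟩ (by simp [hE])
  have hcl := mem_closure_of_load_lt hE h hmax hx hxt
  have hcirc := (h.1 t).fundCircuit_isCircuit hcl (by simpa using hxt)
  refine M.closure_subset_closure ?_
    (hcirc.mem_closure_sdiff_singleton_of_mem (M.mem_fundCircuit x _))
  rintro y ⟨hy, hyx⟩
  have hyx : y ≠ x := hyx
  have hyI : y ∈ I t := by simpa [hyx] using M.fundCircuit_subset_insert x _ hy
  refine ⟨hyI, ?_⟩
  rw [(h.1 t).mem_fundCircuit_iff hcl (by simpa using hxt)] at hy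
  have hind : M.Indep (insert x ((I t).erase y) : Finset α) := by
    rwa [coe_insert, coe_erase, Set.insert_sdiff_singleton_comm hyx.symm]
  refine hR' _ ⟨t, x, y, hxt, hyI, hx, hind, rfl⟩ y ?_
  have h₁ := load_update_add I t (insert x ((I t).erase y)) y
  have h₂ := h.2 y
  simp [hyI, hyx] at h₁
  omega

theorem Exchange.closure_inter_eq (hE : M.E = Set.univ) (h : IsPacking M a I)
    (hmax : ∀ I' : ι → Finset α, IsPacking M a I' → ∑ t, #(I' t) ≤ ∑ t, #(I t))
    {R : Set α} (hR : ∀ z, load I z < a z → z ∈ R)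
    (hR' : ∀ I', Exchange M a I I' → ∀ z, load I' z < a z → z ∈ R)
    (hI : Exchange M a I I') (s : ι) : M.closure (I' s ∩ R) = M.closure (I s ∩ R) := by
  have hI' := hI
  obtain ⟨t, x, y, hx, hy, hlt, hind, rfl⟩ := hI
  obtain rfl | hs := eq_or_ne s t
  swap
  · rw [Function.update_of_ne hs]
  have hxy : x ≠ y := fun hxy => hx (hxy ▸ hy)
  have hyR : y ∈ R := by
    refine hR' _ hI' y ?_
    have h₁ := load_update_add I s (insert x ((I s).erase y)) y
    have h₂ := h.2 y
    simp [hy, hxy.symm] at h₁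
    omega
  have hxcl := mem_closure_inter_of_load_lt hE h hmax hR hR' hlt s
  have hyIR : y ∈ (I s : Set α) ∩ R := ⟨by simpa using hy, hyR⟩
  have h₁ : insert y (((I s : Set α) ∩ R) \ {y}) = (I s : Set α) ∩ R := by
    rw [Set.insert_sdiff_singleton, Set.insert_eq_of_mem hyIR]
  have h₂ : ((insert x ((I s).erase y) : Finset α) : Set α) ∩ R
      = insert x (((I s : Set α) ∩ R) \ {y}) := by
    rw [coe_insert, coe_erase, Set.insert_inter_of_mem (hR x hlt), Set.sdiff_inter_right_comm]
  have hind' : M.Indep (insert x (((I s : Set α) ∩ R) \ {y})) :=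
    h₂ ▸ hind.subset Set.inter_subset_left
  rw [Function.update_self, h₂]
  refine (M.closure_insert_congr ⟨h₁.symm ▸ hxcl, ?_⟩).trans (by rw [h₁])
  rwa [(hind'.subset (Set.subset_insert _ _)).notMem_closure_iff_of_notMem
    (fun hx' => hx (by simpa using hx'.1.1)) (by simp [hE])]

/-- Edmonds' base packing theorem, with capacities. -/
theorem exists_isBase_packing [Fintype α] (hE : M.E = Set.univ)
    (h : ∀ B R J : Finset α, M.IsBase B → M.IsBasis J R →
      Fintype.card ι * #B ≤ ∑ x ∈ Rᶜ, a x + Fintype.card ι * #J) :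
    ∃ I : ι → Finset α, (∀ t, M.IsBase (I t)) ∧ ∀ x, load I x ≤ a x := by
  classical
  obtain ⟨I, hI, hmax⟩ := exists_max_image ({I | IsPacking M a I} : Finset (ι → Finset α))
    (fun I => ∑ t, #(I t)) ⟨fun _ => ∅, mem_filter.2 ⟨mem_univ _, by simp [IsPacking, load]⟩⟩
  simp only [mem_filter, mem_univ, true_and] at hI hmax
  refine ⟨I, fun t₀ => ?_, hI.2⟩
  let Reach := Relation.ReflTransGen (Exchange M a) I
  let R : Finset α := {x | ∃ I', Reach I' ∧ load I' x < a x}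
  have hR : ∀ I', Reach I' → ∀ z, load I' z < a z → z ∈ (R : Set α) := fun I' hI' z hz => by
    simpa [R] using ⟨I', hI', hz⟩
  have key : ∀ I', Reach I' → IsPacking M a I' ∧ ∑ t, #(I' t) = ∑ t, #(I t) ∧
      ∀ t, M.closure (I' t ∩ R) = M.closure (I t ∩ R) := by
    intro I' hI'
    induction hI' with
    | refl => exact ⟨hI, rfl, fun _ => rfl⟩
    | tail hJ hex ih =>
      obtain ⟨h₁, h₂, h₃⟩ := ih
      refine ⟨h₁.exchange hex, hex.sum_card.trans h₂, fun t => ?_⟩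
      rw [← h₃]
      exact hex.closure_inter_eq hE h₁ (by rwa [h₂]) (hR _ hJ)
        (fun K hK => hR K (hJ.tail hK)) t
  have hbasis : ∀ t, M.IsBasis (I t ∩ R : Finset α) R := by
    intro t
    rw [coe_inter]
    refine ((hI.1 t).inter_right _).isBasis_of_subset_of_subset_closure Set.inter_subset_right ?_
    intro x hx
    obtain ⟨I', hI', hx⟩ : ∃ I', Reach I' ∧ load I' x < a x := by simpa [R] using hx
    obtain ⟨h₁, h₂, h₃⟩ := key I' hI'
    rw [← h₃]
    exact mem_closure_inter_of_load_lt hE h₁ (by rwa [h₂]) (hR _ hI')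
      (fun K hK => hR K (hI'.tail hK)) hx t
  by_contra hbase
  have hsup : ∀ t, ∃ B : Finset α, M.IsBase B ∧ I t ⊆ B := fun t => by
    obtain ⟨B, hB, hIB⟩ := (hI.1 t).exists_isBase_superset
    exact ⟨B.toFinset, by simpa using hB, by simpa [← coe_subset] using hIB⟩
  obtain ⟨B, hB, hIB⟩ := hsup t₀
  have hle : ∀ t, #(I t) ≤ #B := fun t => by
    obtain ⟨B', hB', hIB'⟩ := hsup t
    exact (card_le_card hIB').trans_eq (hB'.card_eq_card hB)
  have hlt : #(I t₀) < #B := card_lt_card <| hIB.ssubset_of_ne fun he => hbase (he ▸ hB)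
  have hsum : ∑ t, #(I t) < Fintype.card ι * #B := by
    simpa using sum_lt_sum (fun t _ => hle t) ⟨t₀, mem_univ _, hlt⟩
  have hinter : ∀ t, #(I t ∩ R) = #(I t₀ ∩ R) := fun t =>
    le_antisymm ((hbasis t).indep.card_le_card_of_isBasis (hbasis t).subset (hbasis t₀))
      ((hbasis t₀).indep.card_le_card_of_isBasis (hbasis t₀).subset (hbasis t))
  have htight : ∑ x ∈ Rᶜ, a x = ∑ t, #(I t ∩ Rᶜ) := by
    rw [← sum_load]
    refine sum_congr rfl fun x hx => le_antisymm ?_ (hI.2 x)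
    by_contra hlt
    exact mem_compl.1 hx (by simpa using hR I .refl x (not_le.1 hlt))
  have hsplit : ∑ t, #(I t) = ∑ t, #(I t ∩ Rᶜ) + Fintype.card ι * #(I t₀ ∩ R) := by
    rw [← smul_eq_mul, ← card_univ, ← sum_const, ← sum_add_distrib]
    refine sum_congr rfl fun t _ => ?_
    rw [← hinter t, ← sdiff_eq_inter_compl, card_sdiff_add_card_inter]
  have := h B R _ hB (hbasis t₀)
  omega

end Packing

/-- The matroid whose independent sets are the members of `𝓘`. -/
def IndepSystem.matroid {n : ℕ} {𝓘 : Set (Finset (Fin n))} (h : IndepSystem 𝓘) :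
    Matroid (Fin n) :=
  (IndepMatroid.ofFinset Set.univ (· ∈ 𝓘) h.1 (fun I J hJ hIJ => h.2.1 J hJ I hIJ)
    (fun I J hI hJ => h.2.2 I hI J hJ) (fun _ _ => Set.subset_univ _)).matroid

theorem IndepSystem.matroid_indep {n : ℕ} {𝓘 : Set (Finset (Fin n))} (h : IndepSystem 𝓘)
    {I : Finset (Fin n)} : h.matroid.Indep I ↔ I ∈ 𝓘 := by
  simp [IndepSystem.matroid]

theorem IndepSystem.matroid_isBase {n : ℕ} {𝓘 : Set (Finset (Fin n))} (h : IndepSystem 𝓘)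
    {S : Finset (Fin n)} : h.matroid.IsBase S ↔ IsBasisOf 𝓘 S := by
  rw [Matroid.isBase_iff_maximal_indep, maximal_subset_iff, h.matroid_indep, IsBasisOf]
  refine and_congr_right fun _ => ⟨fun H I hI hSI => ?_, fun H I hI hSI => ?_⟩
  · exact_mod_cast (H (h.matroid_indep.2 hI) (by exact_mod_cast hSI)).symm
  · lift I to Finset (Fin n) using I.toFinite
    exact_mod_cast (H I (h.matroid_indep.1 hI) (by exact_mod_cast hSI)).symm

theorem basisReesGen_eq_intCast (n q : ℕ) (B : Fin q → Finset (Fin n)) (s : Fin n ⊕ Fin q)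
    (i : Fin (n + 1)) : basisReesGen n q B s i = (basisReesGenZ n q B s i : ℝ) := by
  rcases s with l | j
  · simp [basisReesGen, basisReesGenZ, Pi.single_apply]
  · induction i using Fin.lastCases <;> simp [basisReesGen, basisReesGenZ]

theorem sum_mul_basisReesGenZ_castSucc {K : Type*} [CommRing K] {n q : ℕ}
    (B : Fin q → Finset (Fin n)) (c : Fin n ⊕ Fin q → K) (i : Fin n) :
    ∑ s, c s * (basisReesGenZ n q B s i.castSucc : K)
      = c (Sum.inl i) + ∑ j, if i ∈ B j then c (Sum.inr j) else 0 := by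
  simp [basisReesGenZ, Pi.single_apply]

theorem sum_mul_basisReesGenZ_last {K : Type*} [CommRing K] {n q : ℕ}
    (B : Fin q → Finset (Fin n)) (c : Fin n ⊕ Fin q → K) :
    ∑ s, c s * (basisReesGenZ n q B s (Fin.last n) : K) = ∑ j, c (Sum.inr j) := by
  simp [basisReesGenZ, (Fin.castSucc_ne_last _).symm]

theorem mem_basisReesCone_iff {n q : ℕ} {B : Fin q → Finset (Fin n)} {y : Fin (n + 1) → ℝ} :
    y ∈ basisReesCone n q B ↔ ∃ c : Fin n ⊕ Fin q → ℝ, (∀ s, 0 ≤ c s) ∧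
      ∀ i, y i = ∑ s, c s * (basisReesGenZ n q B s i : ℝ) := by
  simp [basisReesCone, funext_iff, basisReesGen_eq_intCast]

/-- If a weight vector dominates a nonnegative combination of bases of total weight `k`, then it
satisfies the rank inequalities of the base packing theorem. -/
theorem card_mul_le_of_sum_isBase_le {α κ : Type*} [Fintype α] [DecidableEq α] [Fintype κ]
    {M : Matroid α} {B : κ → Finset α} (hB : ∀ j, M.IsBase (B j)) {a : α → ℕ} {k : ℕ}
    {c : κ → ℝ} (hc : ∀ j, 0 ≤ c j) (hk : ∑ j, c j = k)
    (ha : ∀ x, (∑ j, if x ∈ B j then c j else 0) ≤ a x)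
    {S R J : Finset α} (hS : M.IsBase S) (hJ : M.IsBasis J R) :
    k * #S ≤ ∑ x ∈ Rᶜ, a x + k * #J := by
  have hcard : ∀ j, (#S : ℝ) ≤ #(B j ∩ Rᶜ) + #J := fun j => by
    have h₁ : #(B j ∩ R) ≤ #J := by
      refine Matroid.Indep.card_le_card_of_isBasis ((hB j).indep.subset ?_) ?_ hJ
      · exact_mod_cast inter_subset_left
      · exact_mod_cast inter_subset_right
    have h₂ := card_sdiff_add_card_inter (B j) R
    rw [sdiff_eq_inter_compl] at h₂
    have h₃ := (hB j).card_eq_card hS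
    exact_mod_cast (by omega : #S ≤ #(B j ∩ Rᶜ) + #J)
  have hsum : ∑ j, c j * #(B j ∩ Rᶜ) ≤ ∑ x ∈ Rᶜ, (a x : ℝ) := by
    refine le_of_eq_of_le ?_ (sum_le_sum fun x _ => ha x)
    rw [sum_comm]
    refine sum_congr rfl fun j _ => ?_
    rw [← sum_filter, sum_const, filter_mem_eq_inter, inter_comm, nsmul_eq_mul, mul_comm]
  have hmain : (k : ℝ) * #S ≤ ∑ x ∈ Rᶜ, (a x : ℝ) + k * #J := calc
    (k : ℝ) * #S = ∑ j, c j * #S := by rw [← hk, sum_mul]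
    _ ≤ ∑ j, c j * (#(B j ∩ Rᶜ) + #J) :=
      sum_le_sum fun j _ => mul_le_mul_of_nonneg_left (hcard j) (hc j)
    _ = ∑ j, c j * #(B j ∩ Rᶜ) + k * #J := by
      rw [← hk, sum_mul, ← sum_add_distrib]
      simp_rw [mul_add]
    _ ≤ _ := by gcongr
  exact_mod_cast hmain

theorem load_comp_eq_sum {ι κ α : Type*} [Fintype ι] [Fintype κ] [DecidableEq κ] [DecidableEq α]
    (B : κ → Finset α) (f : ι → κ) (x : α) :
    load (fun t => B (f t)) x = ∑ j, if x ∈ B j then #{t | f t = j} else 0 := by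
  rw [load, card_eq_sum_card_fiberwise (f := f) (t := univ) (by simp)]
  refine sum_congr rfl fun j _ => ?_
  split_ifs with hj
  · congr 1
    ext t
    simp only [mem_filter, mem_univ, true_and]
    exact ⟨And.right, fun h => ⟨h ▸ hj, h⟩⟩
  · rw [card_eq_zero, filter_eq_empty_iff]
    rintro t ht rfl
    exact hj (by simpa using ht)

/-- The set `𝒜' = {e_1, …, e_n, f_{B_1}, …, f_{B_q}}` attached to the bases of a
matroid is an integral Hilbert basis: every lattice point of the basis Rees cone
is a nonnegative integer combination of elements of `𝒜'`.  (Ring-theoretically: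
the Rees algebra of the basis monomial ideal of a matroid is normal.) -/
theorem basis_monomial_ideal_rees_algebra_normal
    (n q : ℕ) (𝓘 : Set (Finset (Fin n))) (h𝓘 : IndepSystem 𝓘)
    (B : Fin q → Finset (Fin n))
    (hB : ∀ j, IsBasisOf 𝓘 (B j))
    (hall : ∀ S, IsBasisOf 𝓘 S → ∃ j, B j = S)
    (z : Fin (n + 1) → ℤ) :
    (fun i => (z i : ℝ)) ∈ basisReesCone n q B ↔
      ∃ μ : Fin n ⊕ Fin q → ℕ, z = ∑ s, (μ s : ℤ) • basisReesGenZ n q B s := by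
  rw [mem_basisReesCone_iff]
  constructor
  · rintro ⟨c, hc, hz⟩
    have hcast : ∀ i : Fin n, (z i.castSucc : ℝ)
        = c (Sum.inl i) + ∑ j, if i ∈ B j then c (Sum.inr j) else 0 := fun i =>
      (hz i.castSucc).trans (sum_mul_basisReesGenZ_castSucc B c i)
    have hlast : (z (Fin.last n) : ℝ) = ∑ j, c (Sum.inr j) :=
      (hz (Fin.last n)).trans (sum_mul_basisReesGenZ_last B c)
    have hznonneg : ∀ i, 0 ≤ z i := fun i => by
      have : (0 : ℝ) ≤ z i := by
        induction i using Fin.lastCases with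
        | last => exact hlast ▸ sum_nonneg fun j _ => hc _
        | cast i =>
          rw [hcast]
          exact add_nonneg (hc _) (sum_nonneg fun j _ => by split_ifs <;> simp [hc])
      exact_mod_cast this
    lift z to Fin (n + 1) → ℕ using hznonneg
    simp only [Int.cast_natCast] at hcast hlast
    obtain ⟨I, hI, hload⟩ := exists_isBase_packing (ι := Fin (z (Fin.last n))) (M := h𝓘.matroid)
      (a := fun i => z i.castSucc) rfl fun S R J hS hJ => by
        rw [Fintype.card_fin]
        exact card_mul_le_of_sum_isBase_le (fun j => h𝓘.matroid_isBase.2 (hB j))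
          (fun j => hc (Sum.inr j)) hlast.symm
          (fun i => (hcast i).symm ▸ le_add_of_nonneg_left (hc _)) hS hJ
    choose f hf using fun t => hall _ (h𝓘.matroid_isBase.1 (hI t))
    obtain rfl : (fun t => B (f t)) = I := funext hf
    refine ⟨Sum.elim (fun i => z i.castSucc - load (fun t => B (f t)) i)
      (fun j => #{t | f t = j}), funext fun i => ?_⟩
    simp only [Finset.sum_apply, Pi.smul_apply, smul_eq_mul]
    induction i using Fin.lastCases with
    | last =>
      refine Eq.trans ?_ (sum_mul_basisReesGenZ_last (K := ℤ) B _).symm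
      have h := card_eq_sum_card_fiberwise (f := f) (s := univ) (t := univ) (by simp)
      rw [card_univ, Fintype.card_fin] at h
      simpa using congrArg (Nat.cast (R := ℤ)) h
    | cast i =>
      refine Eq.trans ?_ (sum_mul_basisReesGenZ_castSucc (K := ℤ) B _ i).symm
      have h := load_comp_eq_sum B f i
      simp only [Sum.elim_inl, Sum.elim_inr]
      have h' := hload i
      have h₁ : (∑ j, if i ∈ B j then ((#{t | f t = j} : ℕ) : ℤ) else 0)
          = (load (fun t => B (f t)) i : ℤ) := by
        rw [h]
        push_cast
        rfl
      rw [h₁]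
      omega
  · rintro ⟨μ, rfl⟩
    exact ⟨fun s => μ s, fun s => by positivity, fun i => by simp⟩
end
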